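/- Total-variation convergence of the separable approximation (Lemma 5, last part): with l* ∈ ℝ^d, l* > 0 componentwise, let f_γ(x) = φ_Σ(x)·1{x ≥ γΣl*}/ℓ(γ) be the truncated Gaussian density, where ℓ(γ) = ∫_{x ≥ γΣl*} φ_Σ(x) dx. Choose σ̄ ∈ ℝ^d with σ̄_k = √(Σ_{kk}) and ν_γ = γ(Σ − D)l*, where D = diag(Σ_{11},…,Σ_{dd}). Then the product truncated Gaussian density φ̲(·;ν_γ,σ̄) with lower bound γΣl* converges to f_γ in total variation: (1/2)∫_{ℝ^d} |f_γ(x) − φ̲(x;ν_γ,σ̄)| dx → 0 as γ → ∞. -/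

import Mathlib

open MeasureTheory Real Filter Matrix

/-- Standard normal density on ℝ. -/
noncomputable def stdPdf (t : ℝ) : ℝ := (Real.sqrt (2 * Real.pi))⁻¹ * Real.exp (-t ^ 2 / 2)

/-- Standard normal cumulative distribution function Φ. -/
noncomputable def Phi (t : ℝ) : ℝ := ∫ s in Set.Iic t, stdPdf s

/-- Centered Gaussian density with covariance Σ:
φ_Σ(x) = ((2π)^d det Σ)^{-1/2} exp(−xᵀΣ^{-1}x/2). -/
noncomputable def gaussDens {d : ℕ} (S : Matrix (Fin d) (Fin d) ℝ) (x : Fin d → ℝ) : ℝ :=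
  (Real.sqrt ((2 * Real.pi) ^ d * S.det))⁻¹ * Real.exp (-(x ⬝ᵥ S⁻¹.mulVec x) / 2)

/-- Product truncated Gaussian density φ̲(x;ν,σ) with lower bound l and upper bound +∞:
φ̲(x;ν,σ) = Π_k σ_k^{-1}φ((x_k−ν_k)/σ_k)·1{x_k ≥ l_k}/(1 − Φ((l_k−ν_k)/σ_k)). -/
noncomputable def truncProdL {d : ℕ} (l ν σ x : Fin d → ℝ) : ℝ :=
  ∏ k, (σ k)⁻¹ * stdPdf ((x k - ν k) / σ k) *
      (if l k ≤ x k then (1 : ℝ) else 0) / (1 - Phi ((l k - ν k) / σ k))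

/-- One-sided region {x : x ≥ γΣl*}. -/
def regGam {d : ℕ} (S : Matrix (Fin d) (Fin d) ℝ) (lstar : Fin d → ℝ) (γ : ℝ) :
    Set (Fin d → ℝ) := {x | ∀ k, γ * S.mulVec lstar k ≤ x k}

/-- ℓ(γ) = ∫_{x ≥ γΣl*} φ_Σ(x) dx. -/
noncomputable def ellG {d : ℕ} (S : Matrix (Fin d) (Fin d) ℝ) (lstar : Fin d → ℝ)
    (γ : ℝ) : ℝ := ∫ x in regGam S lstar γ, gaussDens S x

open ProbabilityTheory

theorem integral_eq_pow_mul_integral_affine {d : ℕ} (F : (Fin d → ℝ) → ℝ) (a : Fin d → ℝ)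
    {R : ℝ} (hR : 0 < R) : ∫ x, F x = R ^ d * ∫ z, F (a + R • z) := by
  have h := Measure.integral_comp_smul (volume : Measure (Fin d → ℝ)) (fun y => F (a + y)) R
  rw [integral_add_left_eq_self (μ := (volume : Measure (Fin d → ℝ))) F a] at h
  rw [h, Module.finrank_fin_fun, abs_of_pos (by positivity), smul_eq_mul]
  field_simp

/-- The `L¹` distance of two normalized functions is invariant under a common affine change of
variables and under rescaling of each function. -/
theorem integral_abs_sub_div_integral_affine {d : ℕ} {g h G H : (Fin d → ℝ) → ℝ}
    (a : Fin d → ℝ) {R c c' : ℝ} (hR : 0 < R) (hc : c ≠ 0) (hc' : c' ≠ 0)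
    (hg : ∀ z, g (a + R • z) = c * G z) (hh : ∀ z, h (a + R • z) = c' * H z) :
    ∫ x, |g x / (∫ y, g y) - h x / ∫ y, h y| = ∫ z, |G z / (∫ y, G y) - H z / ∫ y, H y| := by
  have hgi := integral_eq_pow_mul_integral_affine g a hR
  have hhi := integral_eq_pow_mul_integral_affine h a hR
  simp only [hg, hh, integral_const_mul] at hgi hhi
  rw [integral_eq_pow_mul_integral_affine _ a hR, hgi, hhi, ← integral_const_mul]
  congr 1 with z
  have hRd : 0 < R ^ d := pow_pos hR d
  rw [hg, hh, ← abs_of_pos hRd, ← abs_mul, abs_of_pos hRd]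
  congr 1
  rw [mul_sub]
  congr 1 <;> field_simp

theorem tendsto_mul_exp_neg_div_sq (e q : ℝ) :
    Tendsto (fun γ : ℝ => e * Real.exp (-q * γ⁻¹ ^ 2 / 2)) atTop (nhds e) := by
  have h : Tendsto (fun γ : ℝ => e * Real.exp (-q * γ⁻¹ ^ 2 / 2)) atTop
      (nhds (e * Real.exp (-q * 0 ^ 2 / 2))) :=
    (((tendsto_inv_atTop_zero.pow 2).const_mul (-q)).div_const 2).rexp.const_mul e
  simpa using h

theorem norm_mul_exp_neg_le {e q : ℝ} (he : 0 ≤ e) (hq : 0 ≤ q) (γ : ℝ) :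
    ‖e * Real.exp (-q * γ⁻¹ ^ 2 / 2)‖ ≤ e := by
  rw [Real.norm_eq_abs, abs_of_nonneg (by positivity)]
  refine mul_le_of_le_one_right he (Real.exp_le_one_iff.2 ?_)
  have : 0 ≤ q * γ⁻¹ ^ 2 := by positivity
  linarith

section Perturbation

variable {α : Type*} [MeasurableSpace α] {μ : Measure α} {E q r : α → ℝ}

theorem aestronglyMeasurable_mul_exp_neg (hE : Integrable E μ) (hqm : Measurable q) (γ : ℝ) :
    AEStronglyMeasurable (fun z => E z * Real.exp (-q z * γ⁻¹ ^ 2 / 2)) μ :=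
  hE.aestronglyMeasurable.mul (by fun_prop)

theorem tendsto_integral_mul_exp_neg (hE : Integrable E μ) (hE0 : ∀ z, 0 ≤ E z)
    (hqm : Measurable q) (hq : ∀ z, 0 ≤ q z) :
    Tendsto (fun γ : ℝ => ∫ z, E z * Real.exp (-q z * γ⁻¹ ^ 2 / 2) ∂μ) atTop
      (nhds (∫ z, E z ∂μ)) :=
  tendsto_integral_filter_of_dominated_convergence E
    (.of_forall fun γ => aestronglyMeasurable_mul_exp_neg hE hqm γ)
    (.of_forall fun γ => .of_forall fun z => norm_mul_exp_neg_le (hE0 z) (hq z) γ) hE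
    (.of_forall fun z => tendsto_mul_exp_neg_div_sq (E z) (q z))

theorem tendsto_integral_abs_sub_normalized (hE : Integrable E μ) (hE0 : ∀ z, 0 ≤ E z)
    (hEpos : 0 < ∫ z, E z ∂μ) (hqm : Measurable q) (hq : ∀ z, 0 ≤ q z)
    (hrm : Measurable r) (hr : ∀ z, 0 ≤ r z) :
    Tendsto (fun γ : ℝ => ∫ z,
      |E z * Real.exp (-q z * γ⁻¹ ^ 2 / 2) / (∫ y, E y * Real.exp (-q y * γ⁻¹ ^ 2 / 2) ∂μ) -
        E z * Real.exp (-r z * γ⁻¹ ^ 2 / 2) / ∫ y, E y * Real.exp (-r y * γ⁻¹ ^ 2 / 2) ∂μ| ∂μ)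
      atTop (nhds 0) := by
  have hqi := tendsto_integral_mul_exp_neg hE hE0 hqm hq
  have hri := tendsto_integral_mul_exp_neg hE hE0 hrm hr
  set I := ∫ z, E z ∂μ with hI
  have key : ∀ e t J : ℝ, 0 ≤ e → I / 2 < J → 0 ≤ t → ∀ γ : ℝ,
      |e * Real.exp (-t * γ⁻¹ ^ 2 / 2) / J| ≤ e / (I / 2) := by
    intro e t J he hJ ht γ
    have hJ0 : 0 < J := by linarith
    rw [abs_div, abs_of_pos hJ0]
    exact div_le_div₀ he (norm_mul_exp_neg_le he ht γ) (by linarith) hJ.le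
  have := tendsto_integral_filter_of_dominated_convergence (μ := μ) (l := atTop) (f := fun _ => 0)
    (F := fun (γ : ℝ) z =>
      |E z * Real.exp (-q z * γ⁻¹ ^ 2 / 2) / (∫ y, E y * Real.exp (-q y * γ⁻¹ ^ 2 / 2) ∂μ) -
        E z * Real.exp (-r z * γ⁻¹ ^ 2 / 2) / ∫ y, E y * Real.exp (-r y * γ⁻¹ ^ 2 / 2) ∂μ|)
    (fun z => E z / (I / 2) + E z / (I / 2)) ?_ ?_ ?_ ?_
  · simpa using this
  · simp only [div_eq_mul_inv _ (∫ y, _ ∂μ)]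
    exact .of_forall fun γ =>
      (((aestronglyMeasurable_mul_exp_neg hE hqm γ).mul_const _).sub
        ((aestronglyMeasurable_mul_exp_neg hE hrm γ).mul_const _)).norm
  · filter_upwards [hqi.eventually_const_lt (half_lt_self hEpos),
      hri.eventually_const_lt (half_lt_self hEpos)] with γ h1 h2
    refine .of_forall fun z => ?_
    rw [Real.norm_eq_abs, abs_abs]
    exact (abs_sub _ _).trans (add_le_add (key _ _ _ (hE0 z) h1 (hq z) γ)
      (key _ _ _ (hE0 z) h2 (hr z) γ))
  · exact (hE.div_const _).add (hE.div_const _)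
  · refine .of_forall fun z => ?_
    have h := (((tendsto_mul_exp_neg_div_sq (E z) (q z)).div hqi hEpos.ne').sub
      ((tendsto_mul_exp_neg_div_sq (E z) (r z)).div hri hEpos.ne')).abs
    simpa using h

end Perturbation

/-- The unnormalized density of a product of exponential laws with rates `l k`. -/
noncomputable def expProd {d : ℕ} (l z : Fin d → ℝ) : ℝ :=
  ∏ k, Set.indicator (Set.Ici 0) (fun t => Real.exp (-l k * t)) (z k)

theorem expProd_nonneg {d : ℕ} (l z : Fin d → ℝ) : 0 ≤ expProd l z :=
  Finset.prod_nonneg fun _ _ => Set.indicator_nonneg (fun _ _ => (Real.exp_pos _).le) _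

theorem expProd_eq_exp {d : ℕ} (l : Fin d → ℝ) {z : Fin d → ℝ} (hz : ∀ k, 0 ≤ z k) :
    expProd l z = Real.exp (-(l ⬝ᵥ z)) := by
  rw [expProd, dotProduct, ← Finset.sum_neg_distrib, Real.exp_sum]
  refine Finset.prod_congr rfl fun k _ => ?_
  rw [Set.indicator_of_mem (Set.mem_Ici.2 (hz k)), neg_mul]

theorem expProd_eq_zero {d : ℕ} (l : Fin d → ℝ) {z : Fin d → ℝ} (hz : ¬ ∀ k, 0 ≤ z k) :
    expProd l z = 0 := by
  push Not at hz
  obtain ⟨k, hk⟩ := hz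
  exact Finset.prod_eq_zero (Finset.mem_univ k)
    (Set.indicator_of_notMem (by simpa using hk) _)

theorem integrable_expProd {d : ℕ} {l : Fin d → ℝ} (hl : ∀ k, 0 < l k) :
    Integrable (expProd l) :=
  Integrable.fintype_prod (f := fun k => Set.indicator (Set.Ici 0) fun t => Real.exp (-l k * t))
    fun k => (integrable_indicator_iff measurableSet_Ici).2
      ((integrableOn_Ici_iff_integrableOn_Ioi).2 (exp_neg_integrableOn_Ioi 0 (hl k)))

theorem integral_expProd_pos {d : ℕ} {l : Fin d → ℝ} (hl : ∀ k, 0 < l k) :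
    0 < ∫ z, expProd l z := by
  have h := integral_fintype_prod_volume_eq_prod
    (fun k => Set.indicator (Set.Ici (0 : ℝ)) fun t => Real.exp (-l k * t))
  simp only [expProd, h]
  refine Finset.prod_pos fun k _ => ?_
  rw [integral_indicator measurableSet_Ici, integral_Ici_eq_integral_Ioi,
    integral_exp_mul_Ioi (by simpa using hl k)]
  simpa using hl k

theorem gaussDens_affine {d : ℕ} {S : Matrix (Fin d) (Fin d) ℝ} (hS : S.PosDef)
    (l z : Fin d → ℝ) {γ : ℝ} (hγ : γ ≠ 0) :
    gaussDens S (γ • S.mulVec l + γ⁻¹ • z) =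
      (Real.sqrt ((2 * Real.pi) ^ d * S.det))⁻¹ * Real.exp (-(γ ^ 2 * (S.mulVec l ⬝ᵥ l)) / 2) *
        (Real.exp (-(l ⬝ᵥ z)) * Real.exp (-(z ⬝ᵥ S⁻¹.mulVec z) * γ⁻¹ ^ 2 / 2)) := by
  have hdet : IsUnit S.det := hS.det_pos.ne'.isUnit
  have hsymm : Sᵀ = S := by simpa using hS.isHermitian.eq
  have h1 : S⁻¹.mulVec (S.mulVec l) = l := by
    rw [mulVec_mulVec, nonsing_inv_mul _ hdet, one_mulVec]
  have h2 : S.mulVec l ⬝ᵥ S⁻¹.mulVec z = l ⬝ᵥ z := by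
    rw [dotProduct_mulVec, ← mulVec_transpose, transpose_nonsing_inv, hsymm, h1]
  rw [gaussDens, mul_assoc, ← Real.exp_add, ← Real.exp_add]
  congr 2
  simp only [mulVec_add, mulVec_smul, h1, add_dotProduct, dotProduct_add, smul_dotProduct,
    dotProduct_smul, h2, smul_eq_mul, dotProduct_comm z l]
  field_simp
  ring

theorem mem_regGam_affine_iff {d : ℕ} (S : Matrix (Fin d) (Fin d) ℝ) (l z : Fin d → ℝ) {γ : ℝ}
    (hγ : 0 < γ) : γ • S.mulVec l + γ⁻¹ • z ∈ regGam S l γ ↔ ∀ k, 0 ≤ z k := by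
  have : 0 < γ⁻¹ := inv_pos.2 hγ
  simp [regGam, mul_nonneg_iff_of_pos_left this]

theorem indicator_gaussDens_affine {d : ℕ} {S : Matrix (Fin d) (Fin d) ℝ} (hS : S.PosDef)
    (l z : Fin d → ℝ) {γ : ℝ} (hγ : 0 < γ) :
    Set.indicator (regGam S l γ) (gaussDens S) (γ • S.mulVec l + γ⁻¹ • z) =
      (Real.sqrt ((2 * Real.pi) ^ d * S.det))⁻¹ * Real.exp (-(γ ^ 2 * (S.mulVec l ⬝ᵥ l)) / 2) *
        (expProd l z * Real.exp (-(z ⬝ᵥ S⁻¹.mulVec z) * γ⁻¹ ^ 2 / 2)) := by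
  by_cases hz : ∀ k, 0 ≤ z k
  · rw [Set.indicator_of_mem ((mem_regGam_affine_iff S l z hγ).2 hz), gaussDens_affine hS l z hγ.ne',
      expProd_eq_exp l hz]
  · rw [Set.indicator_of_notMem (mt (mem_regGam_affine_iff S l z hγ).1 hz), expProd_eq_zero l hz]
    simp

theorem measurableSet_regGam {d : ℕ} (S : Matrix (Fin d) (Fin d) ℝ) (l : Fin d → ℝ) (γ : ℝ) :
    MeasurableSet (regGam S l γ) := by
  rw [regGam, Set.ofPred_forall]
  exact .iInter fun k => measurableSet_le measurable_const (measurable_pi_apply k)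

theorem stdPdf_eq_gaussianPDFReal : stdPdf = gaussianPDFReal 0 1 := by
  ext t
  simp [stdPdf, gaussianPDFReal]

theorem stdPdf_pos (t : ℝ) : 0 < stdPdf t := by
  unfold stdPdf
  positivity

theorem integrable_stdPdf : Integrable stdPdf := by
  rw [stdPdf_eq_gaussianPDFReal]
  exact integrable_gaussianPDFReal 0 1

theorem integral_Ioi_stdPdf (a : ℝ) : ∫ t in Set.Ioi a, stdPdf t = 1 - Phi a := by
  have h := integral_add_compl (measurableSet_Iic (a := a)) integrable_stdPdf
  have h1 : ∫ t, stdPdf t = 1 := by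
    rw [stdPdf_eq_gaussianPDFReal]
    exact integral_gaussianPDFReal_eq_one 0 one_ne_zero
  rw [h1, Set.compl_Iic] at h
  rw [← h, Phi]
  ring

theorem one_sub_Phi_pos (a : ℝ) : 0 < 1 - Phi a := by
  rw [← integral_Ioi_stdPdf, setIntegral_pos_iff_support_of_nonneg_ae
    (.of_forall fun t => (stdPdf_pos t).le) integrable_stdPdf.integrableOn]
  have : Function.support stdPdf = Set.univ := Set.eq_univ_of_forall fun t => (stdPdf_pos t).ne'
  simp [this]

theorem integral_truncNormal (l ν : ℝ) {σ : ℝ} (hσ : 0 < σ) :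
    ∫ t, σ⁻¹ * stdPdf ((t - ν) / σ) * (if l ≤ t then (1 : ℝ) else 0) /
      (1 - Phi ((l - ν) / σ)) = 1 := by
  have h : ∀ t, σ⁻¹ * stdPdf ((t - ν) / σ) * (if l ≤ t then (1 : ℝ) else 0) /
      (1 - Phi ((l - ν) / σ)) =
      σ⁻¹ / (1 - Phi ((l - ν) / σ)) *
        Set.indicator (Set.Ici ((l - ν) / σ)) stdPdf ((t - ν) / σ) := by
    intro t
    have : (l - ν) / σ ≤ (t - ν) / σ ↔ l ≤ t := by
      rw [div_le_div_iff_of_pos_right hσ, sub_le_sub_iff_right]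
    by_cases ht : l ≤ t
    · rw [if_pos ht, Set.indicator_of_mem (Set.mem_Ici.2 (this.2 ht))]
      ring
    · rw [if_neg ht, Set.indicator_of_notMem (fun h => ht (this.1 (Set.mem_Ici.1 h)))]
      simp
  simp only [h]
  rw [integral_const_mul, integral_sub_right_eq_self
    (fun t => Set.indicator (Set.Ici ((l - ν) / σ)) stdPdf (t / σ)) ν,
    Measure.integral_comp_div, integral_indicator measurableSet_Ici,
    integral_Ici_eq_integral_Ioi, integral_Ioi_stdPdf, abs_of_pos hσ, smul_eq_mul]
  have := (one_sub_Phi_pos ((l - ν) / σ)).ne'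
  field_simp

theorem integral_truncProdL {d : ℕ} (l ν : Fin d → ℝ) {σ : Fin d → ℝ} (hσ : ∀ k, 0 < σ k) :
    ∫ x, truncProdL l ν σ x = 1 := by
  have h := integral_fintype_prod_volume_eq_prod (fun k t =>
    (σ k)⁻¹ * stdPdf ((t - ν k) / σ k) * (if l k ≤ t then (1 : ℝ) else 0) /
      (1 - Phi ((l k - ν k) / σ k)))
  simp only [truncProdL, h, integral_truncNormal _ _ (hσ _), Finset.prod_const_one]

theorem stdPdf_affine {s : ℝ} (hs : 0 < s) (l m z : ℝ) {γ : ℝ} (hγ : γ ≠ 0) :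
    stdPdf ((γ * m + γ⁻¹ * z - γ * (m - s * l)) / Real.sqrt s) =
      (Real.sqrt (2 * Real.pi))⁻¹ * Real.exp (-(γ ^ 2 * s * l ^ 2) / 2) *
        (Real.exp (-l * z) * Real.exp (-(z ^ 2 / s) * γ⁻¹ ^ 2 / 2)) := by
  rw [stdPdf, mul_assoc, ← Real.exp_add, ← Real.exp_add, div_pow, Real.sq_sqrt hs.le]
  congr 2
  field_simp
  ring

theorem truncProdL_affine {d : ℕ} {S : Matrix (Fin d) (Fin d) ℝ} (hS : ∀ k, 0 < S k k)
    (l : Fin d → ℝ) {γ : ℝ} (hγ : 0 < γ) :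
    ∃ c : ℝ, c ≠ 0 ∧ ∀ z, truncProdL (fun k => γ * S.mulVec l k)
      (fun k => γ * (S - Matrix.diagonal (fun i => S i i)).mulVec l k)
      (fun k => Real.sqrt (S k k)) (γ • S.mulVec l + γ⁻¹ • z) =
        c * (expProd l z * Real.exp (-(∑ k, z k ^ 2 / S k k) * γ⁻¹ ^ 2 / 2)) := by
  have hγ' : 0 < γ⁻¹ := inv_pos.2 hγ
  refine ⟨∏ k, (Real.sqrt (S k k))⁻¹ * ((Real.sqrt (2 * Real.pi))⁻¹ *
    Real.exp (-(γ ^ 2 * S k k * l k ^ 2) / 2)) /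
      (1 - Phi ((γ * S.mulVec l k - γ * (S.mulVec l k - S k k * l k)) / Real.sqrt (S k k))),
    Finset.prod_ne_zero_iff.2 fun k _ => ?_, fun z => ?_⟩
  · have := hS k
    have := one_sub_Phi_pos
      ((γ * S.mulVec l k - γ * (S.mulVec l k - S k k * l k)) / Real.sqrt (S k k))
    positivity
  · have hsum : -(∑ k, z k ^ 2 / S k k) * γ⁻¹ ^ 2 / 2 =
        ∑ k, -(z k ^ 2 / S k k) * γ⁻¹ ^ 2 / 2 := by
      rw [← Finset.sum_neg_distrib, Finset.sum_mul, Finset.sum_div]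
    rw [hsum, Real.exp_sum, truncProdL, expProd, ← Finset.prod_mul_distrib,
      ← Finset.prod_mul_distrib]
    refine Finset.prod_congr rfl fun k _ => ?_
    simp only [sub_mulVec, mulVec_diagonal, Pi.sub_apply, Pi.add_apply, Pi.smul_apply, smul_eq_mul,
      stdPdf_affine (hS k) _ _ _ hγ.ne', le_add_iff_nonneg_right,
      mul_nonneg_iff_of_pos_left hγ']
    by_cases hz : 0 ≤ z k
    · rw [if_pos hz, Set.indicator_of_mem (Set.mem_Ici.2 hz)]
      ring
    · rw [if_neg hz, Set.indicator_of_notMem (by simpa using hz)]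
      simp

/-- Lemma 5, last part: with σ̄_k = √(Σ_kk) and ν_γ = γ(Σ − D)l*,
D = diag(Σ_11,…,Σ_dd), the product truncated Gaussian φ̲(·;ν_γ,σ̄) with lower bound γΣl*
converges in total variation to the truncated Gaussian density
f_γ = φ_Σ·1{x ≥ γΣl*}/ℓ(γ): (1/2)∫|f_γ − φ̲(·;ν_γ,σ̄)| → 0 as γ → ∞. -/
theorem separable_tv_convergence {d : ℕ} (hd : 1 ≤ d)
    (S : Matrix (Fin d) (Fin d) ℝ) (hS : S.PosDef)
    (lstar : Fin d → ℝ) (hlstar : ∀ k, 0 < lstar k) :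
    Tendsto
      (fun γ : ℝ => (1 / 2) * ∫ x : Fin d → ℝ,
        |Set.indicator (regGam S lstar γ) (gaussDens S) x / ellG S lstar γ -
          truncProdL (fun k => γ * S.mulVec lstar k)
            (fun k => γ * (S - Matrix.diagonal (fun i => S i i)).mulVec lstar k)
            (fun k => Real.sqrt (S k k)) x|)
      atTop (nhds 0) := by
  have hdiag : ∀ k, 0 < S k k := fun k => hS.diag_pos
  have hq : ∀ z : Fin d → ℝ, 0 ≤ z ⬝ᵥ S⁻¹.mulVec z := fun z => by
    simpa using hS.inv.posSemidef.dotProduct_mulVec_nonneg z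
  have hlim := tendsto_integral_abs_sub_normalized (integrable_expProd hlstar)
    (expProd_nonneg lstar) (integral_expProd_pos hlstar)
    (q := fun z => z ⬝ᵥ S⁻¹.mulVec z) (r := fun z => ∑ k, z k ^ 2 / S k k)
    (Continuous.measurable (by fun_prop)) hq (Continuous.measurable (by fun_prop))
    fun z => Finset.sum_nonneg fun k _ => div_nonneg (sq_nonneg _) (hdiag k).le
  have hlim' := hlim.const_mul (1 / 2)
  rw [mul_zero] at hlim'
  refine hlim'.congr' ?_
  filter_upwards [eventually_gt_atTop 0] with γ hγ
  obtain ⟨c, hc, hprod⟩ := truncProdL_affine hdiag lstar hγ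
  have hdet := hS.det_pos
  rw [← integral_abs_sub_div_integral_affine (γ • S.mulVec lstar) (inv_pos.2 hγ)
    (by positivity) hc (fun z => indicator_gaussDens_affine hS lstar z hγ) hprod]
  rw [integral_truncProdL _ _ fun k => Real.sqrt_pos.2 (hdiag k),
    integral_indicator (measurableSet_regGam S lstar γ)]
  simp only [div_one, ellG]
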